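/- arXiv:2408.00206 — 3 statements merged into one kernel-verified Lean document; each statement's English description precedes it below -/
import Mathlib

section
/- (Matheron's rule, pushforward form.) Let (a, b) be a jointly Gaussian random vector taking values in ℝᵐ × ℝⁿ, with mean (μ_a, μ_b) and covariance matrix with blocks Σ_aa = Cov(a,a), Σ_ab = Cov(a,b), Σ_ba = Σ_abᵀ, Σ_bb = Cov(b,b), where Σ_bb is positive definite. Then for any fixed vector β ∈ ℝⁿ, the random vector a + Σ_ab Σ_bb⁻¹ (β − b) is Gaussian with mean μ_a + Σ_ab Σ_bb⁻¹ (β − μ_b) and covariance matrix Σ_aa − Σ_ab Σ_bb⁻¹ Σ_ba. -/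
open MeasureTheory ProbabilityTheory Matrix
open scoped NNReal

/-- A measure `μ` on `ι → ℝ` is the Gaussian (multivariate normal) distribution with
mean vector `m` and covariance matrix `S` iff it is a probability measure and every
linear functional `x ↦ ∑ i, t i * x i` pushes it forward to the one-dimensional
Gaussian with mean `∑ i, t i * m i` and variance `tᵀ S t` (Cramér–Wold). -/
def IsGaussianVec {ι : Type*} [Fintype ι] (μ : Measure (ι → ℝ))
    (m : ι → ℝ) (S : Matrix ι ι ℝ) : Prop :=
  IsProbabilityMeasure μ ∧
    ∀ t : ι → ℝ,
      μ.map (fun x => ∑ i, t i * x i) =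
        gaussianReal (∑ i, t i * m i) (Real.toNNReal (t ⬝ᵥ S *ᵥ t))

theorem measurable_add_mulVec {ι κ : Type*} [Fintype ι] (L : Matrix κ ι ℝ) (c : κ → ℝ) :
    Measurable fun x : ι → ℝ => c + L *ᵥ x := by
  unfold Matrix.mulVec dotProduct
  fun_prop

/-- The image of a Gaussian vector under an affine map is Gaussian. -/
theorem IsGaussianVec.map_affine {ι κ : Type*} [Fintype ι] [Fintype κ] {μ : Measure (ι → ℝ)}
    {m : ι → ℝ} {S : Matrix ι ι ℝ} (h : IsGaussianVec μ m S) (L : Matrix κ ι ℝ) (c : κ → ℝ) :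
    IsGaussianVec (μ.map (fun x => c + L *ᵥ x)) (c + L *ᵥ m) (L * S * Lᵀ) := by
  have := h.1
  have hL := measurable_add_mulVec L c
  have key (t : κ → ℝ) (x : ι → ℝ) :
      ∑ i, t i * (c + L *ᵥ x) i = t ⬝ᵥ c + ∑ i, (Lᵀ *ᵥ t) i * x i := by
    change t ⬝ᵥ (c + L *ᵥ x) = t ⬝ᵥ c + (Lᵀ *ᵥ t) ⬝ᵥ x
    rw [dotProduct_add, dotProduct_mulVec, mulVec_transpose]
  have quad (t : κ → ℝ) : t ⬝ᵥ (L * S * Lᵀ) *ᵥ t = (Lᵀ *ᵥ t) ⬝ᵥ S *ᵥ (Lᵀ *ᵥ t) := by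
    rw [← mulVec_mulVec, ← mulVec_mulVec, dotProduct_mulVec t L, mulVec_transpose]
  refine ⟨Measure.isProbabilityMeasure_map hL.aemeasurable, fun t => ?_⟩
  rw [Measure.map_map (by fun_prop) hL, key, quad, add_comm, ← gaussianReal_map_const_add,
    ← h.2, Measure.map_map (by fun_prop) (by fun_prop)]
  congr 1
  exact funext (key t)

/-- **Matheron's rule, pushforward form.**  If `(a, b)` is jointly Gaussian
with mean `(μa, μb)` and block covariance `[[Saa, Sab], [Sabᵀ, Sbb]]`, `Sbb` positive
definite, then for any fixed `β` the random vector `a + Sab Sbb⁻¹ (β − b)` is Gaussian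
with mean `μa + Sab Sbb⁻¹ (β − μb)` and covariance `Saa − Sab Sbb⁻¹ Sabᵀ`. -/
theorem matheron_rule_pushforward {m n : ℕ} (hm : 0 < m) (hn : 0 < n)
    {Ω : Type*} [MeasurableSpace Ω] (P : Measure Ω) [IsProbabilityMeasure P]
    (a : Ω → Fin m → ℝ) (b : Ω → Fin n → ℝ) (ha : Measurable a) (hb : Measurable b)
    (μa : Fin m → ℝ) (μb : Fin n → ℝ)
    (Saa : Matrix (Fin m) (Fin m) ℝ) (Sab : Matrix (Fin m) (Fin n) ℝ)
    (Sbb : Matrix (Fin n) (Fin n) ℝ) (hSbb : Sbb.PosDef)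
    (hjoint : IsGaussianVec (P.map (fun ω => Sum.elim (a ω) (b ω)))
      (Sum.elim μa μb) (Matrix.fromBlocks Saa Sab Sabᵀ Sbb))
    (β : Fin n → ℝ) :
    IsGaussianVec (P.map (fun ω => a ω + Sab *ᵥ (Sbb⁻¹ *ᵥ (β - b ω))))
      (μa + Sab *ᵥ (Sbb⁻¹ *ᵥ (β - μb)))
      (Saa - Sab * Sbb⁻¹ * Sabᵀ) := by
  have hinv : Sbb⁻¹ * Sbb = 1 :=
    nonsing_inv_mul _ ((isUnit_iff_isUnit_det Sbb).1 hSbb.isUnit)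
  have affine (x : Fin m → ℝ) (y : Fin n → ℝ) :
      Sab *ᵥ (Sbb⁻¹ *ᵥ β) + fromCols 1 (-(Sab * Sbb⁻¹)) *ᵥ Sum.elim x y =
        x + Sab *ᵥ (Sbb⁻¹ *ᵥ (β - y)) := by
    simp only [fromCols_mulVec_sumElim, one_mulVec, neg_mulVec, mulVec_sub, mulVec_mulVec]
    abel
  have cov : fromCols (1 : Matrix (Fin m) (Fin m) ℝ) (-(Sab * Sbb⁻¹)) * fromBlocks Saa Sab Sabᵀ Sbb *
      (fromCols (1 : Matrix (Fin m) (Fin m) ℝ) (-(Sab * Sbb⁻¹)))ᵀ = Saa - Sab * Sbb⁻¹ * Sabᵀ := by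
    rw [fromCols_mul_fromBlocks, transpose_fromCols, fromCols_mul_fromRows]
    simp [Matrix.mul_assoc, hinv, sub_eq_add_neg]
  have hmeas : Measurable fun ω => Sum.elim (a ω) (b ω) := by
    refine measurable_pi_iff.2 (Sum.rec (fun i => ?_) fun j => ?_)
    · exact (measurable_pi_apply i).comp ha
    · exact (measurable_pi_apply j).comp hb
  have hgauss := hjoint.map_affine (fromCols 1 (-(Sab * Sbb⁻¹))) (Sab *ᵥ (Sbb⁻¹ *ᵥ β))
  rw [Measure.map_map (measurable_add_mulVec _ _) hmeas, affine, cov] at hgauss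
  simpa only [Function.comp_def, affine] using hgauss
end

section
/- (Matheron's rule for noisy GP posterior sampling.) Let (f_X, f_*) be a jointly Gaussian random vector in ℝⁿ × ℝᵐ with mean (μ_X, μ_*) and covariance blocks K_{X,X}, K_{X,*}, K_{*,X} = K_{X,*}ᵀ, K_{*,*}. Let ε be a Gaussian random vector in ℝⁿ with mean 0 and covariance σ² Iₙ, where σ > 0, independent of (f_X, f_*), and let y ∈ ℝⁿ be a fixed vector. Then the random vector f_* + K_{*,X} (K_{X,X} + σ² Iₙ)⁻¹ (y − f_X − ε) is Gaussian with mean μ_* + K_{*,X}(K_{X,X} + σ² Iₙ)⁻¹ (y − μ_X) and covariance matrix K_{*,*} − K_{*,X} (K_{X,X} + σ² Iₙ)⁻¹ K_{X,*}. In particular its law equals the Gaussian-process regression posterior distribution of f_* given noisy observations y = f_X + ε. -/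
open MeasureTheory ProbabilityTheory Matrix
open scoped NNReal

/-- A linear functional of a Gaussian vector has variance the positive part of the
quadratic form of the covariance matrix. -/
lemma measurable_dotProduct_left {ι : Type*} [Fintype ι] (t : ι → ℝ) :
    Measurable fun x => t ⬝ᵥ x := by
  unfold dotProduct; fun_prop

lemma IsGaussianVec.hasLaw_dotProduct {ι : Type*} [Fintype ι] {μ : Measure (ι → ℝ)}
    {m : ι → ℝ} {S : Matrix ι ι ℝ} (h : IsGaussianVec μ m S) (t : ι → ℝ) :
    HasLaw (fun x => t ⬝ᵥ x) (gaussianReal (t ⬝ᵥ m) (Real.toNNReal (t ⬝ᵥ S *ᵥ t))) μ :=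
  ⟨(measurable_dotProduct_left t).aemeasurable, h.2 t⟩

lemma IsGaussianVec.memLp_dotProduct {ι : Type*} [Fintype ι] {μ : Measure (ι → ℝ)}
    {m : ι → ℝ} {S : Matrix ι ι ℝ} (h : IsGaussianVec μ m S) (t : ι → ℝ) :
    MemLp (fun x => t ⬝ᵥ x) 2 μ := by
  have hlaw := h.hasLaw_dotProduct t
  exact MemLp.comp_of_map (g := id) (hlaw.map_eq ▸ memLp_id_gaussianReal 2) hlaw.aemeasurable

/-- A linear functional of a Gaussian vector has variance the positive part of the
quadratic form of the covariance matrix. -/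
lemma IsGaussianVec.variance_dotProduct {ι : Type*} [Fintype ι] {μ : Measure (ι → ℝ)}
    {m : ι → ℝ} {S : Matrix ι ι ℝ} (h : IsGaussianVec μ m S) (t : ι → ℝ) :
    Var[fun x => t ⬝ᵥ x; μ] = max (t ⬝ᵥ S *ᵥ t) 0 := by
  rw [(h.hasLaw_dotProduct t).variance_eq, variance_id_gaussianReal, Real.coe_toNNReal']

/-- If the covariance matrix of a Gaussian vector (whose quadratic form only enters through its
positive part) takes a negative value, then the law is degenerate and the quadratic form is
nowhere positive. -/
lemma IsGaussianVec.quadForm_nonpos_of_neg {ι : Type*} [Fintype ι] {μ : Measure (ι → ℝ)}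
    {m : ι → ℝ} {S : Matrix ι ι ℝ} (h : IsGaussianVec μ m S) {a : ι → ℝ}
    (ha : a ⬝ᵥ S *ᵥ a < 0) (u : ι → ℝ) : u ⬝ᵥ S *ᵥ u ≤ 0 := by
  have := h.1
  set q := a ⬝ᵥ S *ᵥ a
  set b := u ⬝ᵥ S *ᵥ a + a ⬝ᵥ S *ᵥ u with hb
  set r := u ⬝ᵥ S *ᵥ u
  obtain ⟨s, hs1, hs2⟩ : ∃ s : ℝ, r + s * b + s ^ 2 * q ≤ 0 ∧ r - s * b + s ^ 2 * q ≤ 0 := by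
    have hq : 0 < -q := neg_pos.mpr ha
    have hs0 : 0 ≤ (|r| + |b|) / -q := by positivity
    refine ⟨1 + (|r| + |b|) / -q, ?_⟩
    set c := (|r| + |b|) / -q
    have hc : c * q = -(|r| + |b|) := by
      simp only [c]; field_simp [ha.ne]
    have h1 := le_abs_self r
    have h2 := le_abs_self b
    have h3 := neg_abs_le b
    have h4 := abs_nonneg r
    have h5 : (1 + c) ^ 2 * q ≤ -((1 + c) * (|r| + |b|)) := by
      have : (1 + c) ^ 2 * q = (1 + c) * q + (1 + c) * (c * q) := by ring
      rw [this, hc]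
      nlinarith
    constructor <;> nlinarith
  have hvar := h.variance_dotProduct
  have hadd := variance_add (h.memLp_dotProduct u) (h.memLp_dotProduct (s • a))
  have hsub := variance_sub (h.memLp_dotProduct u) (h.memLp_dotProduct (s • a))
  have eadd : ((fun x => u ⬝ᵥ x) + fun x => (s • a) ⬝ᵥ x) = fun x => (u + s • a) ⬝ᵥ x := by
    ext x; simp [add_dotProduct]
  have esub : ((fun x => u ⬝ᵥ x) - fun x => (s • a) ⬝ᵥ x) = fun x => (u - s • a) ⬝ᵥ x := by
    ext x; simp [sub_dotProduct]
  have qadd : (u + s • a) ⬝ᵥ S *ᵥ (u + s • a) = r + s * b + s ^ 2 * q := by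
    simp only [add_dotProduct, mulVec_add, dotProduct_add, mulVec_smul, smul_dotProduct,
      dotProduct_smul, smul_eq_mul, hb, q, r]
    ring
  have qsub : (u - s • a) ⬝ᵥ S *ᵥ (u - s • a) = r - s * b + s ^ 2 * q := by
    simp only [sub_dotProduct, mulVec_sub, dotProduct_sub, mulVec_smul, smul_dotProduct,
      dotProduct_smul, smul_eq_mul, hb, q, r]
    ring
  rw [eadd, hvar, qadd, max_eq_right hs1, hvar u] at hadd
  rw [esub, hvar, qsub, max_eq_right hs2, hvar u] at hsub
  have := le_max_left r 0
  have := variance_nonneg (fun x => (s • a) ⬝ᵥ x) μ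
  linarith

/-- **Matheron's rule for noisy GP posterior sampling.**
If `(fX, fs)` is jointly Gaussian with mean `(μX, μs)` and covariance blocks
`KXX, KXs, KXsᵀ, Kss`, and `ε` is an independent Gaussian noise vector with mean `0`
and covariance `σ² Iₙ`, then for any fixed `y` the random vector
`fs + KXsᵀ (KXX + σ² Iₙ)⁻¹ (y − fX − ε)` is Gaussian with mean
`μs + KXsᵀ (KXX + σ² Iₙ)⁻¹ (y − μX)` and covariance
`Kss − KXsᵀ (KXX + σ² Iₙ)⁻¹ KXs`, i.e. its law is the GP regression posterior. -/
theorem matheron_rule_noisy_posterior {n m : ℕ} (hn : 0 < n) (hm : 0 < m)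
    {Ω : Type*} [MeasurableSpace Ω] (P : Measure Ω) [IsProbabilityMeasure P]
    (fX : Ω → Fin n → ℝ) (fs : Ω → Fin m → ℝ) (ε : Ω → Fin n → ℝ)
    (hfX : Measurable fX) (hfs : Measurable fs) (hε : Measurable ε)
    (μX : Fin n → ℝ) (μs : Fin m → ℝ)
    (KXX : Matrix (Fin n) (Fin n) ℝ) (KXs : Matrix (Fin n) (Fin m) ℝ)
    (Kss : Matrix (Fin m) (Fin m) ℝ) (hKXX : KXX.PosSemidef)
    (σ : ℝ) (hσ : 0 < σ)
    (hjoint : IsGaussianVec (P.map (fun ω => Sum.elim (fX ω) (fs ω)))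
      (Sum.elim μX μs) (Matrix.fromBlocks KXX KXs KXsᵀ Kss))
    (hεlaw : IsGaussianVec (P.map ε) 0 (σ ^ 2 • (1 : Matrix (Fin n) (Fin n) ℝ)))
    (hindep : IndepFun (fun ω => Sum.elim (fX ω) (fs ω)) ε P)
    (y : Fin n → ℝ) :
    IsGaussianVec
      (P.map (fun ω =>
        fs ω + KXsᵀ *ᵥ ((KXX + σ ^ 2 • (1 : Matrix (Fin n) (Fin n) ℝ))⁻¹ *ᵥ
          (y - fX ω - ε ω))))
      (μs + KXsᵀ *ᵥ ((KXX + σ ^ 2 • (1 : Matrix (Fin n) (Fin n) ℝ))⁻¹ *ᵥ (y - μX)))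
      (Kss - KXsᵀ * (KXX + σ ^ 2 • (1 : Matrix (Fin n) (Fin n) ℝ))⁻¹ * KXs) := by
  set A := KXX + σ ^ 2 • (1 : Matrix (Fin n) (Fin n) ℝ) with hA
  have hApos : A.PosDef := Matrix.PosDef.posSemidef_add hKXX (PosDef.one.smul (by positivity))
  have hAsymm : Aᵀ = A := by simpa using hApos.isHermitian.eq
  have hAinv : A * A⁻¹ = 1 := Matrix.mul_nonsing_inv A (A.isUnit_iff_isUnit_det.mp hApos.isUnit)
  have hmeas : Measurable fun ω => Sum.elim (fX ω) (fs ω) := by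
    refine measurable_pi_iff.mpr ?_
    rintro (i | i)
    · exact (measurable_pi_apply i).comp hfX
    · exact (measurable_pi_apply i).comp hfs
  have hlin {k l : ℕ} (B : Matrix (Fin k) (Fin l) ℝ) : Measurable fun v => B *ᵥ v := by
    unfold mulVec dotProduct; fun_prop
  have hout : Measurable fun ω => fs ω + KXsᵀ *ᵥ (A⁻¹ *ᵥ (y - fX ω - ε ω)) :=
    hfs.add ((hlin _).comp ((hlin _).comp ((measurable_const.sub hfX).sub hε)))
  refine ⟨Measure.isProbabilityMeasure_map hout.aemeasurable, fun t => ?_⟩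
  obtain ⟨w, hw⟩ : ∃ w, w = A⁻¹ *ᵥ (KXs *ᵥ t) := ⟨_, rfl⟩
  have hAw : A *ᵥ w = KXs *ᵥ t := by rw [hw, mulVec_mulVec, hAinv, one_mulVec]
  have hpull (v : Fin n → ℝ) : t ⬝ᵥ KXsᵀ *ᵥ (A⁻¹ *ᵥ v) = w ⬝ᵥ v := by
    rw [dotProduct_mulVec, vecMul_transpose, dotProduct_mulVec, ← mulVec_transpose,
      transpose_nonsing_inv, hAsymm, hw]
  have hquad (v : Fin n → ℝ) : Sum.elim v t ⬝ᵥ fromBlocks KXX KXs KXsᵀ Kss *ᵥ Sum.elim v t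
      = v ⬝ᵥ KXX *ᵥ v + 2 * (v ⬝ᵥ KXs *ᵥ t) + t ⬝ᵥ Kss *ᵥ t := by
    have : t ⬝ᵥ KXsᵀ *ᵥ v = v ⬝ᵥ KXs *ᵥ t := by
      rw [dotProduct_mulVec, vecMul_transpose, dotProduct_comm]
    simp only [fromBlocks_mulVec, sumElim_dotProduct_sumElim, Sum.elim_comp_inl,
      Sum.elim_comp_inr, dotProduct_add, this]
    ring
  have hAquad : w ⬝ᵥ KXX *ᵥ w + σ ^ 2 * (w ⬝ᵥ w) = w ⬝ᵥ KXs *ᵥ t := by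
    rw [← hAw, hA, add_mulVec, smul_mulVec, one_mulVec, dotProduct_add, dotProduct_smul,
      smul_eq_mul]
  have hww : 0 ≤ w ⬝ᵥ w := by simpa using dotProduct_star_self_nonneg w
  have hKw : 0 ≤ w ⬝ᵥ KXX *ᵥ w := by simpa using hKXX.dotProduct_mulVec_nonneg w
  set q := Sum.elim (-w) t ⬝ᵥ fromBlocks KXX KXs KXsᵀ Kss *ᵥ Sum.elim (-w) t with hq
  have hq' : q = w ⬝ᵥ KXX *ᵥ w - 2 * (w ⬝ᵥ KXs *ᵥ t) + t ⬝ᵥ Kss *ᵥ t := by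
    rw [hq, hquad]; simp [mulVec_neg]; ring
  have hcov : t ⬝ᵥ (Kss - KXsᵀ * A⁻¹ * KXs) *ᵥ t = q + σ ^ 2 * (w ⬝ᵥ w) := by
    rw [sub_mulVec, dotProduct_sub, ← mulVec_mulVec, ← mulVec_mulVec, hpull]
    linarith
  have hdeg (hneg : q < 0) : w ⬝ᵥ w = 0 := by
    have hnonpos (s : ℝ) : 2 * s * (w ⬝ᵥ KXs *ᵥ t) + t ⬝ᵥ Kss *ᵥ t ≤ 0 := by
      have h1 := hjoint.quadForm_nonpos_of_neg hneg (Sum.elim (s • w) t)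
      have h2 : 0 ≤ (s • w) ⬝ᵥ KXX *ᵥ (s • w) := by
        simpa using hKXX.dotProduct_mulVec_nonneg (s • w)
      rw [hquad, smul_dotProduct s w (KXs *ᵥ t), smul_eq_mul] at h1
      linarith
    set c := w ⬝ᵥ KXs *ᵥ t
    set d := t ⬝ᵥ Kss *ᵥ t
    have hc : c ≤ 0 := by
      by_contra! hc
      have := hnonpos ((1 - d) / (2 * c))
      have : 2 * ((1 - d) / (2 * c)) * c = 1 - d := by field_simp
      linarith
    have hσ2 : 0 < σ ^ 2 := by positivity
    nlinarith
  have hvar : Real.toNNReal q + Real.toNNReal (σ ^ 2 * (w ⬝ᵥ w))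
      = Real.toNNReal (q + σ ^ 2 * (w ⬝ᵥ w)) := by
    rcases lt_or_ge q 0 with hneg | hnonneg
    · simp [hdeg hneg]
    · exact (Real.toNNReal_add hnonneg (by positivity)).symm
  have hX : HasLaw (fun ω => Sum.elim (-w) t ⬝ᵥ Sum.elim (fX ω) (fs ω))
      (gaussianReal (-(w ⬝ᵥ μX) + t ⬝ᵥ μs) (Real.toNNReal q)) P := by
    have := (hjoint.hasLaw_dotProduct (Sum.elim (-w) t)).comp ⟨hmeas.aemeasurable, rfl⟩
    rwa [sumElim_dotProduct_sumElim, neg_dotProduct] at this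
  have hY : HasLaw (fun ω => (-w) ⬝ᵥ ε ω)
      (gaussianReal 0 (Real.toNNReal (σ ^ 2 * (w ⬝ᵥ w)))) P := by
    have := (hεlaw.hasLaw_dotProduct (-w)).comp ⟨hε.aemeasurable, rfl⟩
    simpa [smul_mulVec, mulVec_neg, Function.comp_def] using this
  have hXY := gaussianReal_add_const ⟨hX.aemeasurable.add hY.aemeasurable,
    gaussianReal_add_gaussianReal_of_indepFun
      (hindep.comp (measurable_dotProduct_left (Sum.elim (-w) t)) (measurable_dotProduct_left (-w)))
      hX.map_eq hY.map_eq⟩ (w ⬝ᵥ y)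
  have hmap := Measure.map_map (μ := P) (measurable_dotProduct_left t) hout
  refine hmap.trans ?_
  rw [hcov, ← hvar]
  convert hXY.map_eq using 2
  · ext ω
    change t ⬝ᵥ (_ + _) = _
    simp only [dotProduct_add, hpull, dotProduct_sub, sumElim_dotProduct_sumElim, neg_dotProduct,
      Pi.add_apply]
    ring
  · change t ⬝ᵥ (_ + _) = _
    simp only [dotProduct_add, hpull, dotProduct_sub]
    ring
end

section
/- (Matheron's rule with the subset-of-regressors inducing-point approximation.) Let q, n, m be positive integers, let K_{U,U} be a symmetric positive definite q×q matrix, let K_{X,U} = K_{U,X}ᵀ be an n×q matrix and K_{*,U} = K_{U,*}ᵀ an m×q matrix, and let σ > 0. Set Σ_U = K_{U,U} + σ⁻² K_{U,X} K_{X,U}. Suppose (f_X, f_*) is a jointly Gaussian random vector in ℝⁿ × ℝᵐ with mean (μ_X, μ_*) whose covariance matrix is the SoR prior covariance, i.e. the block matrix whose blocks are K_{X,U} K_{U,U}⁻¹ K_{U,X}, K_{X,U} K_{U,U}⁻¹ K_{U,*}, K_{*,U} K_{U,U}⁻¹ K_{U,X}, and K_{*,U} K_{U,U}⁻¹ K_{U,*}.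 Let ε be Gaussian in ℝⁿ with mean 0 and covariance σ² Iₙ, independent of (f_X, f_*), and let y ∈ ℝⁿ be fixed. Then the random vector f_* + σ⁻² K_{*,U} Σ_U⁻¹ K_{U,X} (y − f_X − ε) is Gaussian with mean μ_* + σ⁻² K_{*,U} Σ_U⁻¹ K_{U,X} (y − μ_X) and covariance K_{*,U} Σ_U⁻¹ K_{U,*}; that is, its law equals the SoR predictive distribution q_SoR(f_* | y). -/
open MeasureTheory ProbabilityTheory Matrix
open scoped NNReal

namespace IsGaussianVec

variable {ι κ Ω : Type*} [Fintype ι] [Fintype κ]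

theorem affine_map {μ : Measure (ι → ℝ)} {m : ι → ℝ} {S : Matrix ι ι ℝ}
    (h : IsGaussianVec μ m S) (A : Matrix κ ι ℝ) (b : κ → ℝ) :
    IsGaussianVec (μ.map (fun x => A *ᵥ x + b)) (A *ᵥ m + b) (A * S * Aᵀ) := by
  have := h.1
  have hmeas : Measurable (fun x : ι → ℝ => A *ᵥ x + b) := by
    unfold mulVec dotProduct
    fun_prop
  refine ⟨Measure.isProbabilityMeasure_map hmeas.aemeasurable, fun t => ?_⟩
  have hlin (x : ι → ℝ) : ∑ i, t i * (A *ᵥ x + b) i = ∑ i, (t ᵥ* A) i * x i + t ⬝ᵥ b := by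
    change t ⬝ᵥ (A *ᵥ x + b) = (t ᵥ* A) ⬝ᵥ x + t ⬝ᵥ b
    rw [dotProduct_add, dotProduct_mulVec]
  have hvar : t ⬝ᵥ (A * S * Aᵀ) *ᵥ t = (t ᵥ* A) ⬝ᵥ S *ᵥ (t ᵥ* A) := by
    rw [← mulVec_mulVec, ← mulVec_mulVec, mulVec_transpose, dotProduct_mulVec]
  rw [Measure.map_map (by fun_prop) hmeas, hlin, hvar, ← gaussianReal_map_add_const, ← h.2,
    Measure.map_map (by fun_prop) (by fun_prop)]
  congr 1
  exact funext hlin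

theorem add_of_indepFun [MeasurableSpace Ω] {P : Measure Ω} {X Y : Ω → ι → ℝ}
    {m₁ m₂ : ι → ℝ} {S₁ S₂ : Matrix ι ι ℝ} (hXm : Measurable X) (hYm : Measurable Y)
    (hX : IsGaussianVec (P.map X) m₁ S₁) (hY : IsGaussianVec (P.map Y) m₂ S₂)
    (hXY : IndepFun X Y P) (hS₁ : S₁.PosSemidef) (hS₂ : S₂.PosSemidef) :
    IsGaussianVec (P.map (X + Y)) (m₁ + m₂) (S₁ + S₂) := by
  have := hX.1
  have : IsProbabilityMeasure P := Measure.isProbabilityMeasure_of_map X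
  refine ⟨Measure.isProbabilityMeasure_map (hXm.add hYm).aemeasurable, fun t => ?_⟩
  have hXt := hX.2 t
  have hYt := hY.2 t
  have hT : Measurable (fun x : ι → ℝ => ∑ i, t i * x i) := by fun_prop
  rw [Measure.map_map hT hXm] at hXt
  rw [Measure.map_map hT hYm] at hYt
  have hsum := gaussianReal_add_gaussianReal_of_indepFun (hXY.comp hT hT) hXt hYt
  rw [← Real.toNNReal_add (by simpa using hS₁.dotProduct_mulVec_nonneg t)
    (by simpa using hS₂.dotProduct_mulVec_nonneg t)] at hsum
  rw [Measure.map_map hT (hXm.add hYm), add_mulVec, dotProduct_add]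
  convert hsum using 2
  · ext ω
    simp [mul_add, Finset.sum_add_distrib]
  · simp [mul_add, Finset.sum_add_distrib]

end IsGaussianVec

theorem Measurable.sum_elim_pi {ι κ Ω : Type*} [MeasurableSpace Ω] {f : Ω → ι → ℝ} {g : Ω → κ → ℝ}
    (hf : Measurable f) (hg : Measurable g) :
    Measurable (fun ω => Sum.elim (f ω) (g ω)) := by
  rw [measurable_pi_iff] at hf hg ⊢
  rintro (i | j)
  exacts [hf i, hg j]

/-- **Matheron's rule with the SoR inducing-point approximation.**
With `S_U = K_{U,U} + σ⁻² K_{U,X} K_{X,U}`, if `(fX, fs)` is jointly Gaussian with mean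
`(μX, μs)` and the SoR prior block covariance, and `ε ~ N(0, σ² Iₙ)` is independent,
then for any fixed `y` the vector `fs + σ⁻² K_{*,U} S_U⁻¹ K_{U,X} (y − fX − ε)` is
Gaussian with mean `μs + σ⁻² K_{*,U} S_U⁻¹ K_{U,X} (y − μX)` and covariance
`K_{*,U} S_U⁻¹ K_{U,*}`, i.e. its law is the SoR predictive distribution. -/
theorem matheron_rule_sor {q n m : ℕ} (hq : 0 < q) (hn : 0 < n) (hm : 0 < m)
    {Ω : Type*} [MeasurableSpace Ω] (P : Measure Ω) [IsProbabilityMeasure P]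
    (KUU : Matrix (Fin q) (Fin q) ℝ) (hKUU : KUU.PosDef)
    (KUX : Matrix (Fin q) (Fin n) ℝ) (KUs : Matrix (Fin q) (Fin m) ℝ)
    (σ : ℝ) (hσ : 0 < σ)
    (SU : Matrix (Fin q) (Fin q) ℝ)
    (hSU : SU = KUU + (σ ^ 2)⁻¹ • (KUX * KUXᵀ))
    (fX : Ω → Fin n → ℝ) (fs : Ω → Fin m → ℝ) (ε : Ω → Fin n → ℝ)
    (hfX : Measurable fX) (hfs : Measurable fs) (hε : Measurable ε)
    (μX : Fin n → ℝ) (μs : Fin m → ℝ)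
    (hjoint : IsGaussianVec (P.map (fun ω => Sum.elim (fX ω) (fs ω)))
      (Sum.elim μX μs)
      (Matrix.fromBlocks (KUXᵀ * KUU⁻¹ * KUX) (KUXᵀ * KUU⁻¹ * KUs)
        (KUsᵀ * KUU⁻¹ * KUX) (KUsᵀ * KUU⁻¹ * KUs)))
    (hεlaw : IsGaussianVec (P.map ε) 0 (σ ^ 2 • (1 : Matrix (Fin n) (Fin n) ℝ)))
    (hindep : IndepFun (fun ω => Sum.elim (fX ω) (fs ω)) ε P)
    (y : Fin n → ℝ) :
    IsGaussianVec
      (P.map (fun ω =>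
        fs ω + (σ ^ 2)⁻¹ • ((KUsᵀ * SU⁻¹ * KUX) *ᵥ (y - fX ω - ε ω))))
      (μs + (σ ^ 2)⁻¹ • ((KUsᵀ * SU⁻¹ * KUX) *ᵥ (y - μX)))
      (KUsᵀ * SU⁻¹ * KUs) := by
  set C : Matrix (Fin m) (Fin n) ℝ := (σ ^ 2)⁻¹ • (KUsᵀ * SU⁻¹ * KUX) with hC
  have hσ2 : 0 < σ ^ 2 := by positivity
  have hSUpos : SU.PosDef := by
    rw [hSU]
    refine hKUU.add_posSemidef (PosSemidef.smul ?_ (by positivity))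
    simpa using posSemidef_self_mul_conjTranspose KUX
  have hKdet : IsUnit KUU.det := (isUnit_iff_isUnit_det _).mp hKUU.isUnit
  have hSdet : IsUnit SU.det := (isUnit_iff_isUnit_det _).mp hSUpos.isUnit
  have hKT : KUUᵀ = KUU := by simpa using hKUU.isHermitian.eq
  have hSinvT : SU⁻¹ᵀ = SU⁻¹ := by simpa using hSUpos.inv.isHermitian.eq
  have hKX : (σ ^ 2)⁻¹ • (KUX * KUXᵀ) = SU - KUU := by rw [hSU]; abel
  have hCX : C * KUXᵀ = KUsᵀ - KUsᵀ * SU⁻¹ * KUU := by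
    rw [hC, Matrix.smul_mul, Matrix.mul_assoc, ← Matrix.mul_smul, hKX, Matrix.mul_sub,
      nonsing_inv_mul_cancel_right _ _ hSdet]
  have hblock : fromBlocks (KUXᵀ * KUU⁻¹ * KUX) (KUXᵀ * KUU⁻¹ * KUs)
      (KUsᵀ * KUU⁻¹ * KUX) (KUsᵀ * KUU⁻¹ * KUs) =
      fromRows KUXᵀ KUsᵀ * KUU⁻¹ * fromCols KUX KUs := by
    rw [fromRows_mul, fromRows_mul_fromCols]
  set A : Matrix (Fin m) (Fin n ⊕ Fin m) ℝ := fromCols (-C) 1 with hA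
  have hAB : A * fromRows KUXᵀ KUsᵀ = KUsᵀ * SU⁻¹ * KUU := by
    rw [hA, fromCols_mul_fromRows, Matrix.neg_mul, hCX, Matrix.one_mul]
    abel
  have hBA : fromCols KUX KUs * Aᵀ = KUU * SU⁻¹ * KUs := by
    have := congrArg transpose hAB
    simpa [transpose_mul, transpose_fromRows, hKT, hSinvT, Matrix.mul_assoc] using this
  have hcov₁ : A * fromBlocks (KUXᵀ * KUU⁻¹ * KUX) (KUXᵀ * KUU⁻¹ * KUs)
      (KUsᵀ * KUU⁻¹ * KUX) (KUsᵀ * KUU⁻¹ * KUs) * Aᵀ =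
      KUsᵀ * SU⁻¹ * KUU * SU⁻¹ * KUs := by
    rw [hblock, Matrix.mul_assoc, Matrix.mul_assoc _ (fromCols _ _), hBA, ← Matrix.mul_assoc A,
      ← Matrix.mul_assoc A, hAB, mul_nonsing_inv_cancel_right _ _ hKdet]
    simp only [Matrix.mul_assoc]
  have hcov₂ : -C * (σ ^ 2 • (1 : Matrix (Fin n) (Fin n) ℝ)) * (-C)ᵀ =
      KUsᵀ * SU⁻¹ * KUs - KUsᵀ * SU⁻¹ * KUU * SU⁻¹ * KUs := by
    have hCT : (-C)ᵀ = -((σ ^ 2)⁻¹ • (KUXᵀ * (SU⁻¹ * KUs))) := by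
      simp [hC, transpose_mul, hSinvT]
    rw [hCT, Matrix.mul_smul, Matrix.mul_one, Matrix.smul_mul, Matrix.neg_mul, Matrix.mul_neg, neg_neg, Matrix.mul_smul,
      smul_smul, mul_inv_cancel₀ hσ2.ne', one_smul, ← Matrix.mul_assoc, hCX, Matrix.sub_mul]
    simp only [Matrix.mul_assoc]
  have hpos₁ : (KUsᵀ * SU⁻¹ * KUU * SU⁻¹ * KUs).PosSemidef := by
    have := hKUU.posSemidef.conjTranspose_mul_mul_same (SU⁻¹ * KUs)
    simpa [transpose_mul, hSinvT, Matrix.mul_assoc] using this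
  have hpos₂ : (-C * (σ ^ 2 • (1 : Matrix (Fin n) (Fin n) ℝ)) * (-C)ᵀ).PosSemidef := by
    simpa only [conjTranspose_eq_transpose_of_trivial] using
      (PosSemidef.one.smul hσ2.le).mul_mul_conjTranspose_same (-C)
  have hmeas {k : Type} [Fintype k] (M : Matrix (Fin m) k ℝ) (b : Fin m → ℝ) :
      Measurable (fun x => M *ᵥ x + b) := by
    unfold mulVec dotProduct
    fun_prop
  have hf := hfX.sum_elim_pi hfs
  have h₁ := hjoint.affine_map A (C *ᵥ y)
  have h₂ := hεlaw.affine_map (-C) 0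
  rw [Measure.map_map (hmeas _ _) hf, hcov₁] at h₁
  rw [Measure.map_map (hmeas _ _) hε] at h₂
  have hsum := h₁.add_of_indepFun ((hmeas _ _).comp hf) ((hmeas _ _).comp hε) h₂
    (hindep.comp (hmeas _ _) (hmeas _ _)) hpos₁ hpos₂
  rw [hcov₂, add_sub_cancel] at hsum
  have hCv (v : Fin n → ℝ) : (σ ^ 2)⁻¹ • ((KUsᵀ * SU⁻¹ * KUX) *ᵥ v) = C *ᵥ v :=
    (smul_mulVec _ _ _).symm
  have hmean : μs + C *ᵥ (y - μX) =
      A *ᵥ Sum.elim μX μs + C *ᵥ y + (-C *ᵥ (0 : Fin n → ℝ) + 0) := by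
    simp only [hA, fromCols_mulVec_sumElim, mulVec_sub, neg_mulVec, one_mulVec, mulVec_zero]
    abel
  simp only [hCv]
  rw [hmean]
  convert hsum using 2
  ext1 ω
  simp only [Function.comp_apply, Pi.add_apply, hA, fromCols_mulVec_sumElim, mulVec_sub,
    neg_mulVec, one_mulVec]
  abel
end
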